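/- Every family of m distinct finite sets contains a B_2-free subfamily of size at least 3 · 2^{−7/3} · m^{2/3}. -/

import Mathlib

/-- A family `B` of finite sets forms a Boolean algebra of dimension `d`. -/
def IsBooleanAlgebraDim {α : Type*} [DecidableEq α] (d : ℕ) (B : Finset (Finset α)) : Prop :=
  ∃ f : Finset (Fin d) → Finset α, Function.Injective f ∧
    (∀ I J : Finset (Fin d), f (I ∪ J) = f I ∪ f J ∧ f (I ∩ J) = f I ∩ f J) ∧
    B = Finset.image f Finset.univ

/-- A family is `B_d`-free if no subfamily forms a Boolean algebra of dimension `d`. -/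
def IsBdFree {α : Type*} [DecidableEq α] (d : ℕ) (F : Finset (Finset α)) : Prop :=
  ∀ B ⊆ F, ¬ IsBooleanAlgebraDim d B

open Finset in
/-- The probability that a `p`-random subset of `V` contains the fixed set `T` is `p ^ #T`. -/
lemma sum_powerset_weight_of_subset {β : Type*} [DecidableEq β] (V T : Finset β) (hT : T ⊆ V)
    (p : ℝ) :
    ∑ S ∈ V.powerset, p ^ #S * (1 - p) ^ #(V \ S) * (if T ⊆ S then 1 else 0) = p ^ #T := by
  have h := Finset.prod_add (fun _ : β => p) (fun i => if i ∈ T then 0 else 1 - p) V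
  have h1 : ∏ i ∈ V, (p + if i ∈ T then 0 else 1 - p) = p ^ #T := by
    have : ∀ i ∈ V, (p + if i ∈ T then 0 else 1 - p) = if i ∈ T then p else 1 := by
      intro i _
      split_ifs <;> ring
    rw [Finset.prod_congr rfl this, Finset.prod_ite_mem, Finset.inter_eq_right.mpr hT,
      Finset.prod_const]
  rw [← h1, h]
  refine Finset.sum_congr rfl fun S _ => ?_
  rw [Finset.prod_const, mul_assoc]
  congr 1
  by_cases hTS : T ⊆ S
  · rw [if_pos hTS, mul_one, ← Finset.prod_const]
    refine Finset.prod_congr rfl fun i hi => ?_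
    rw [if_neg fun hiT => (Finset.mem_sdiff.mp hi).2 (hTS hiT)]
  · obtain ⟨i, hiT, hiS⟩ := Finset.not_subset.mp hTS
    rw [if_neg hTS, mul_zero, Finset.prod_eq_zero (Finset.mem_sdiff.mpr ⟨hT hiT, hiS⟩)]
    exact if_pos hiT

open Finset in
/-- The deletion method: a `k`-uniform hypergraph on `V` with edge set `E` has an independent set
of size at least `p * #V - p ^ k * #E`. -/
lemma exists_independent_card_ge {β : Type*} [DecidableEq β] (V : Finset β)
    (E : Finset (Finset β)) {k : ℕ} (hk : k ≠ 0) (hE : ∀ e ∈ E, e ⊆ V ∧ #e = k)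
    {p : ℝ} (hp0 : 0 ≤ p) (hp1 : p ≤ 1) :
    ∃ G ⊆ V, (∀ e ∈ E, ¬ e ⊆ G) ∧ p * #V - p ^ k * #E ≤ (#G : ℝ) := by
  set w : Finset β → ℝ := fun S => p ^ #S * (1 - p) ^ #(V \ S)
  have hw0 : ∀ S, 0 ≤ w S := fun S =>
    mul_nonneg (pow_nonneg hp0 _) (pow_nonneg (sub_nonneg.mpr hp1) _)
  have hw1 : ∑ S ∈ V.powerset, w S = 1 := by
    simpa using sum_powerset_weight_of_subset V ∅ (Finset.empty_subset _) p
  have hcard : ∑ S ∈ V.powerset, w S * #S = p * #V := by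
    have : ∀ S ∈ V.powerset, w S * #S = ∑ v ∈ V, w S * (if {v} ⊆ S then 1 else 0) := by
      intro S hS
      rw [← Finset.mul_sum]
      simp [Finset.inter_eq_right.mpr (Finset.mem_powerset.mp hS)]
    rw [Finset.sum_congr rfl this, Finset.sum_comm, Finset.sum_congr rfl fun v hv =>
      sum_powerset_weight_of_subset V {v} (Finset.singleton_subset_iff.mpr hv) p]
    simp [mul_comm]
  have hedges : ∑ S ∈ V.powerset, w S * #{e ∈ E | e ⊆ S} = p ^ k * #E := by
    have : ∀ S ∈ V.powerset, w S * #{e ∈ E | e ⊆ S} =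
        ∑ e ∈ E, w S * (if e ⊆ S then 1 else 0) := by
      intro S _
      rw [← Finset.mul_sum]
      simp
    rw [Finset.sum_congr rfl this, Finset.sum_comm, Finset.sum_congr rfl fun e he =>
      (sum_powerset_weight_of_subset V e (hE e he).1 p).trans (by rw [(hE e he).2])]
    simp [mul_comm]
  obtain ⟨S, hS, hle⟩ : ∃ S ∈ V.powerset,
      p * #V - p ^ k * #E ≤ (#S : ℝ) - #{e ∈ E | e ⊆ S} := by
    by_contra! hlt
    have hsum : ∑ S ∈ V.powerset, w S * ((#S : ℝ) - #{e ∈ E | e ⊆ S}) =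
        p * #V - p ^ k * #E := by
      simp only [mul_sub, Finset.sum_sub_distrib, hcard, hedges]
    have hstrict : ∑ S ∈ V.powerset, w S * ((#S : ℝ) - #{e ∈ E | e ⊆ S}) <
        ∑ S ∈ V.powerset, w S * (p * #V - p ^ k * #E) := by
      obtain ⟨S, hS, hSw⟩ := Finset.exists_ne_zero_of_sum_ne_zero (hw1.trans_ne one_ne_zero)
      exact Finset.sum_lt_sum
        (fun S hS => mul_le_mul_of_nonneg_left (hlt S hS).le (hw0 S))
        ⟨S, hS, mul_lt_mul_of_pos_left (hlt S hS) ((hw0 S).lt_of_ne' hSw)⟩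
    rw [hsum, ← Finset.sum_mul, hw1, one_mul] at hstrict
    exact lt_irrefl _ hstrict
  have hne : ∀ e : {e // e ∈ E}, ∃ v, v ∈ e.1 := fun e =>
    Finset.card_ne_zero.mp ((hE e.1 e.2).2.trans_ne hk)
  choose v hv using hne
  set D : Finset β := ({e ∈ E.attach | e.1 ⊆ S} : Finset {e // e ∈ E}).image v
  refine ⟨S \ D, Finset.sdiff_subset.trans (Finset.mem_powerset.mp hS), ?_, ?_⟩
  · intro e he heG
    refine (Finset.mem_sdiff.mp (heG (hv ⟨e, he⟩))).2 (Finset.mem_image_of_mem v ?_)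
    exact Finset.mem_filter.mpr ⟨Finset.mem_attach _ _, heG.trans Finset.sdiff_subset⟩
  · have hDcard : #D ≤ #{e ∈ E | e ⊆ S} := by
      refine Finset.card_image_le.trans (Finset.card_le_card_of_injOn Subtype.val ?_
        Subtype.val_injective.injOn)
      intro e he
      simp only [Finset.coe_filter, Set.mem_ofPred_eq] at he ⊢
      exact ⟨e.2, he.2⟩
    have hsdiff : #S ≤ #(S \ D) + #D := by
      have := Finset.le_card_sdiff D S
      omega
    have : (#S : ℝ) ≤ #(S \ D) + #{e ∈ E | e ⊆ S} := by exact_mod_cast hsdiff.trans (by omega)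
    linarith

lemma IsBooleanAlgebraDim.card_eq {α : Type*} [DecidableEq α] {d : ℕ} {B : Finset (Finset α)}
    (hB : IsBooleanAlgebraDim d B) : B.card = 2 ^ d := by
  obtain ⟨f, hf, -, rfl⟩ := hB
  simp [Finset.card_image_of_injective _ hf]

/-- A two-dimensional Boolean algebra is generated by its two middle elements. -/
lemma IsBooleanAlgebraDim.exists_generators {α : Type*} [DecidableEq α]
    {B : Finset (Finset α)} (hB : IsBooleanAlgebraDim 2 B) :
    ∃ P ⊆ B, P.card = 2 ∧ Finset.image₂ (· ∩ ·) P P ∪ Finset.image₂ (· ∪ ·) P P = B := by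
  obtain ⟨f, hf, hfl, rfl⟩ := hB
  have huniv : (Finset.univ : Finset (Finset (Fin 2))) = {∅, {0}, {1}, {0, 1}} := by decide
  have hinter : f {0} ∩ f {1} = f ∅ := (hfl {0} {1}).2.symm.trans (congrArg f (by decide))
  have hunion : f {0} ∪ f {1} = f {0, 1} := (hfl {0} {1}).1.symm.trans (congrArg f (by decide))
  refine ⟨{f {0}, f {1}}, ?_, Finset.card_pair (hf.ne (by decide)), ?_⟩
  · simp [Finset.insert_subset_iff]
  · rw [huniv]
    ext X
    simp only [Finset.image₂_insert_left, Finset.image₂_singleton_left, Finset.image_insert,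
      Finset.image_singleton, Finset.inter_self, Finset.union_self,
      Finset.inter_comm (f {1}) (f {0}), Finset.union_comm (f {1}) (f {0}), hinter, hunion,
      Finset.mem_union, Finset.mem_insert, Finset.mem_singleton]
    tauto

open Classical in
/-- A family of `m` sets contains at most `m.choose 2` two-dimensional Boolean algebras. -/
lemma card_filter_isBooleanAlgebraDim_two_le {α : Type*} [DecidableEq α]
    (F : Finset (Finset α)) :
    (F.powerset.filter (IsBooleanAlgebraDim 2)).card ≤ F.card.choose 2 := by
  rw [← Finset.card_powersetCard]
  refine Finset.card_le_card_of_surjOn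
    (fun P => Finset.image₂ (· ∩ ·) P P ∪ Finset.image₂ (· ∪ ·) P P) ?_
  intro B hB
  obtain ⟨hBF, hB⟩ := Finset.mem_filter.mp (Finset.mem_coe.mp hB)
  obtain ⟨P, hPB, hP, rfl⟩ := hB.exists_generators
  exact ⟨P, Finset.mem_coe.mpr (Finset.mem_powersetCard.mpr
    ⟨hPB.trans (Finset.mem_powerset.mp hBF), hP⟩), by congr!⟩

theorem b2_free_lower_bound {α : Type*} [DecidableEq α]
    (m : ℕ) (F : Finset (Finset α)) (hF : F.card = m) :
    ∃ G ⊆ F, IsBdFree 2 G ∧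
      3 * (2 : ℝ) ^ (-(7 : ℝ) / 3) * (m : ℝ) ^ ((2 : ℝ) / 3) ≤ (G.card : ℝ) := by
  classical
  rcases Nat.eq_zero_or_pos m with rfl | hm
  · refine ⟨∅, Finset.empty_subset _, fun B hB hBool => ?_, ?_⟩
    · have := hBool.card_eq
      simp [Finset.subset_empty.mp hB] at this
    · rw [Nat.cast_zero, Real.zero_rpow (by norm_num)]
      simp
  have hm1 : (1 : ℝ) ≤ m := by exact_mod_cast hm
  have hm0 : (0 : ℝ) < m := by linarith
  set p : ℝ := (2 * (m : ℝ)) ^ (-(1 : ℝ) / 3) with hp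
  have hp0 : 0 ≤ p := by positivity
  have hp1 : p ≤ 1 := Real.rpow_le_one_of_one_le_of_nonpos (by linarith) (by norm_num)
  have hp3 : p ^ 3 * (2 * m) = 1 := by
    rw [hp, ← Real.rpow_natCast, ← Real.rpow_mul (by positivity)]
    norm_num
    rw [Real.rpow_neg_one]
    field_simp
  obtain ⟨G, hGF, hG, hcard⟩ := exists_independent_card_ge F
    (F.powerset.filter (IsBooleanAlgebraDim 2)) (k := 4) (by norm_num)
    (fun B hB => ⟨Finset.mem_powerset.mp (Finset.mem_filter.mp hB).1,
      (Finset.mem_filter.mp hB).2.card_eq⟩) hp0 hp1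
  refine ⟨G, hGF, fun B hB hBool => hG B (Finset.mem_filter.mpr
    ⟨Finset.mem_powerset.mpr (hB.trans hGF), hBool⟩) hB, ?_⟩
  have hedges : ((F.powerset.filter (IsBooleanAlgebraDim 2)).card : ℝ) ≤ (m : ℝ) ^ 2 / 2 := by
    have h := card_filter_isBooleanAlgebraDim_two_le F
    rw [hF] at h
    calc _ ≤ ((m.choose 2 : ℕ) : ℝ) := by exact_mod_cast h
      _ ≤ (m : ℝ) ^ 2 / 2 := by
        rw [Nat.cast_choose_two]
        nlinarith
  have hvalue : 3 * (2 : ℝ) ^ (-(7 : ℝ) / 3) * (m : ℝ) ^ ((2 : ℝ) / 3) = 3 / 4 * (m * p) := by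
    have h2 : (2 : ℝ) ^ (-(7 : ℝ) / 3) = 1 / 4 * 2 ^ (-(1 : ℝ) / 3) := by
      rw [show (-(7 : ℝ) / 3) = -2 + -(1 : ℝ) / 3 by norm_num, Real.rpow_add (by norm_num),
        Real.rpow_neg (by norm_num)]
      norm_num
    have h3 : (m : ℝ) ^ ((2 : ℝ) / 3) = m * (m : ℝ) ^ (-(1 : ℝ) / 3) := by
      rw [show ((2 : ℝ) / 3) = 1 + -(1 : ℝ) / 3 by norm_num, Real.rpow_add hm0, Real.rpow_one]
    rw [h2, h3, hp, Real.mul_rpow (by norm_num) hm0.le]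
    ring
  rw [hvalue]
  rw [hF] at hcard
  have hbound := mul_le_mul_of_nonneg_left hedges (pow_nonneg hp0 4)
  have hp4 : p ^ 4 * ((m : ℝ) ^ 2 / 2) = 1 / 4 * (m * p) := by
    linear_combination (p * m / 4) * hp3
  linarith
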